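/- Let (g,⟨·,·⟩) be a metric Lie algebra that is not unimodular, i.e. Tr(ad_{X₀}) ≠ 0 for some X₀ ∈ g. Then every nonzero X ∈ g orthogonal to the unimodular ideal u = {Y ∈ g : Tr(ad_Y) = 0} is a stationary point of the Euler equation, and for such X at least one of X, −X is unstable; in particular, the Euler equation has an unstable stationary point. -/

import Mathlib

open scoped InnerProductSpace

/-- A Lie algebra structure (a bilinear Lie bracket) on the real inner product space `g`,
making `(g, ⟨·,·⟩)` a metric Lie algebra. -/
structure LieStructure (g : Type*) [NormedAddCommGroup g] [InnerProductSpace ℝ g] where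
  bracket : g →ₗ[ℝ] g →ₗ[ℝ] g
  bracket_self : ∀ x, bracket x x = 0
  jacobi : ∀ x y z, bracket x (bracket y z) + bracket y (bracket z x) + bracket z (bracket x y) = 0

namespace LieStructure

variable {g : Type*} [NormedAddCommGroup g] [InnerProductSpace ℝ g] [FiniteDimensional ℝ g]
variable (L : LieStructure g)

/-- `ad_Y : Z ↦ [Y, Z]`. -/
def ad (Y : g) : g →ₗ[ℝ] g := L.bracket Y

/-- `ad_Yᵗ`, the adjoint of `ad_Y` with respect to the inner product. -/
noncomputable def adT (Y : g) : g →ₗ[ℝ] g := LinearMap.adjoint (L.ad Y)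

/-- A solution of the Euler equation `Ẏ = ad_Yᵗ Y`. -/
def IsSolution (Y : ℝ → g) : Prop := ∀ t : ℝ, HasDerivAt Y (L.adT (Y t) (Y t)) t

/-- A stationary point (equilibrium) of the Euler equation: `ad_Xᵗ X = 0`. -/
def IsStationary (X : g) : Prop := L.adT X X = 0

/-- Lyapunov stability of a point `X` for the Euler equation: every solution starting
close to `X` remains close to `X` for all `t ≥ 0`. -/
def IsStable (X : g) : Prop :=
  ∀ ε > 0, ∃ δ > 0, ∀ Y : ℝ → g, L.IsSolution Y → ‖Y 0 - X‖ < δ → ∀ t ≥ 0, ‖Y t - X‖ < ε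

/-- The linearisation `J_X : Y ↦ ad_Xᵗ Y + ad_Yᵗ X` of the Euler equation at `X`. -/
noncomputable def J (X : g) : g →ₗ[ℝ] g where
  toFun Y := L.adT X Y + L.adT Y X
  map_add' Y Z := by
    simp only [adT, ad, map_add, LinearMap.add_apply]
    abel
  map_smul' c Y := by
    simp only [adT, ad, map_smul, map_smulₛₗ, starRingEnd_apply, star_trivial,
      LinearMap.smul_apply, RingHom.id_apply, smul_add]

/-- `g` is unimodular: `Tr (ad_X) = 0` for all `X`. -/
def IsUnimodular : Prop := ∀ X : g, LinearMap.trace ℝ g (L.ad X) = 0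

/-- The centre of `g`: the set of `X` with `[X, ·] = 0`. -/
def center : Submodule ℝ g := LinearMap.ker L.bracket

end LieStructure

/-- `σ_k(J)`: the `k`-th elementary symmetric function of the eigenvalues of `J`, i.e.
`(-1)^k` times the coefficient of `λ^(n-k)` in the characteristic polynomial
`det (λ·id - J)` of `J`, where `n = dim g`. -/
noncomputable def sigmaCoeff {g : Type*} [NormedAddCommGroup g] [InnerProductSpace ℝ g]
    [FiniteDimensional ℝ g] (k : ℕ) (J : g →ₗ[ℝ] g) : ℝ :=
  (-1 : ℝ) ^ k * (LinearMap.charpoly J).coeff (Module.finrank ℝ g - k)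

section
variable {E : Type*} [NormedAddCommGroup E] [NormedSpace ℝ E] [FiniteDimensional ℝ E]

theorem ContinuousLinearMap.differentiable_det :
    Differentiable ℝ fun A : E →L[ℝ] E => A.det := by
  classical
  let b := Module.finBasis ℝ E
  have hdet : (fun A : E →L[ℝ] E => A.det) = fun A =>
      ∑ σ : Equiv.Perm (Fin (Module.finrank ℝ E)), ((Equiv.Perm.sign σ : ℤ) : ℝ) *
        ∏ i, LinearMap.toContinuousLinearMap (b.coord (σ i)) (A (b i)) := by
    ext A
    rw [ContinuousLinearMap.det, ← LinearMap.det_toMatrix b, Matrix.det_apply']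
    simp [LinearMap.toMatrix_apply]
  rw [hdet]
  fun_prop

theorem ContinuousLinearMap.hasDerivAt_det_one_add_smul (J : E →L[ℝ] E) :
    HasDerivAt (fun r : ℝ => (1 + r • J).det) (LinearMap.trace ℝ E J) 0 := by
  classical
  let b := Module.finBasis ℝ E
  let M := LinearMap.toMatrix b b (J : E →ₗ[ℝ] E)
  let p : Polynomial ℝ := (1 + (Polynomial.X : Polynomial ℝ) • M.map Polynomial.C).det.divX.divX
  have hdet : (fun r : ℝ => (1 + r • J).det) =
      fun r => 1 + M.trace * r + p.eval r * r ^ 2 := by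
    ext r
    rw [← Matrix.det_one_add_smul, ContinuousLinearMap.det, ← LinearMap.det_toMatrix b]
    congr 1
    rw [ContinuousLinearMap.toLinearMap_add, map_add, ContinuousLinearMap.toLinearMap_smul, map_smul]
    congr 1
    exact LinearMap.toMatrix_one b
  rw [hdet, LinearMap.trace_eq_matrix_trace ℝ b]
  have h := (((hasDerivAt_id (0 : ℝ)).const_mul M.trace).const_add 1).add
    ((p.hasDerivAt 0).mul ((hasDerivAt_id (0 : ℝ)).pow 2))
  convert! h using 1
  simp [M]

theorem ContinuousLinearMap.hasDerivAt_det_exp_smul (J : E →L[ℝ] E) :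
    HasDerivAt (fun r : ℝ => (NormedSpace.exp (r • J)).det) (LinearMap.trace ℝ E J) 0 := by
  have hline : HasDerivAt (fun r : ℝ => (1 : E →L[ℝ] E) + r • J) J 0 := by
    simpa using ((hasDerivAt_id (0 : ℝ)).smul_const J).const_add (1 : E →L[ℝ] E)
  have hexp : HasDerivAt (fun r : ℝ => NormedSpace.exp (r • J)) J 0 := by
    simpa using hasDerivAt_exp_smul_const (𝕂 := ℝ) J 0
  have hdet := (ContinuousLinearMap.differentiable_det (E := E) 1).hasFDerivAt
  have hJ := (HasFDerivAt.comp_hasDerivAt_of_eq (0 : ℝ) hdet hline (by simp)).unique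
    (ContinuousLinearMap.hasDerivAt_det_one_add_smul J)
  rw [← hJ]
  exact HasFDerivAt.comp_hasDerivAt_of_eq (0 : ℝ) hdet hexp (by simp)

theorem ContinuousLinearMap.exists_one_lt_det_exp_smul {J : E →L[ℝ] E}
    (hJ : 0 < LinearMap.trace ℝ E J) :
    ∃ h : ℝ, 0 < h ∧ 1 < (NormedSpace.exp (h • J)).det := by
  have hslope := (ContinuousLinearMap.hasDerivAt_det_exp_smul J).tendsto_slope_zero_right
  obtain ⟨h, hh, hpos⟩ := ((hslope.eventually (lt_mem_nhds hJ)).and self_mem_nhdsWithin).exists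
  refine ⟨h, hpos, ?_⟩
  have hlt := (smul_pos_iff_of_pos_left (inv_pos.2 hpos)).1 hh
  simpa [ContinuousLinearMap.det] using hlt

end

/-- A bounded Lipschitz autonomous vector field has global integral curves. -/
theorem exists_forall_hasDerivAt_of_lipschitzWith {F : Type*} [NormedAddCommGroup F]
    [NormedSpace ℝ F] [CompleteSpace F] {v : F → F} {K C : NNReal}
    (hv : LipschitzWith K v) (hC : ∀ x, ‖v x‖ ≤ C) (x : F) :
    ∃ Y : ℝ → F, Y 0 = x ∧ ∀ t, HasDerivAt Y (v (Y t)) t := by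
  have hloc : ∀ T : ℝ, 0 < T → ∃ Y : ℝ → F, Y 0 = x ∧
      ∀ t ∈ Set.Ioo (-T) T, HasDerivAt Y (v (Y t)) t := by
    intro T hT
    have hpl : IsPicardLindelof (fun _ : ℝ => v) (tmin := -T) (tmax := T)
        ⟨0, by constructor <;> linarith⟩ x (C * ⟨T, hT.le⟩) 0 C K :=
      .of_time_independent (fun y _ => hC y) hv.lipschitzOnWith (by simp; rfl)
    obtain ⟨Y, hY0, hY⟩ := hpl.exists_eq_forall_mem_Icc_hasDerivWithinAt₀
    exact ⟨Y, hY0, fun t ht => (hY t (Set.Ioo_subset_Icc_self ht)).hasDerivAt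
      (Icc_mem_nhds ht.1 ht.2)⟩
  choose! Y hY0 hY using hloc
  have hpos : ∀ t : ℝ, 0 < |t| + 1 := fun t => by positivity
  have heq : ∀ S T : ℝ, 0 < S → S ≤ T → Set.EqOn (Y S) (Y T) (Set.Ioo (-S) S) := by
    intro S T hS hST
    refine ODE_solution_unique_of_mem_Ioo (v := fun _ => v) (s := fun _ => Set.univ) (K := K)
      (t₀ := 0) (fun _ _ => hv.lipschitzOnWith) ⟨by linarith, hS⟩
      (fun t ht => ⟨hY S hS t ht, trivial⟩)
      (fun t ht => ⟨hY T (hS.trans_le hST) t ⟨by linarith [ht.1], by linarith [ht.2]⟩, trivial⟩) ?_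
    rw [hY0 S hS, hY0 T (hS.trans_le hST)]
  refine ⟨fun t => Y (|t| + 1) t, hY0 _ (hpos 0), fun t => ?_⟩
  have hmem : Set.Ioo (-(|t| + 1)) (|t| + 1) ∈ nhds t :=
    Ioo_mem_nhds (by linarith [neg_abs_le t]) (by linarith [le_abs_self t])
  refine (hY (|t| + 1) (hpos t) t (mem_of_mem_nhds hmem)).congr_of_eventuallyEq ?_
  filter_upwards [hmem] with s hs
  have hs' : s ∈ Set.Ioo (-(|s| + 1)) (|s| + 1) :=
    ⟨by linarith [neg_abs_le s], by linarith [le_abs_self s]⟩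
  rcases le_total |s| |t| with hst | hst
  · exact heq _ _ (hpos s) (by linarith) hs'
  · exact (heq _ _ (hpos t) (by linarith) hs).symm

/-- A `C¹` vector field tangent to the spheres centred at `0` has global integral curves. -/
theorem exists_forall_hasDerivAt_of_inner_eq_zero {E : Type*} [NormedAddCommGroup E]
    [InnerProductSpace ℝ E] [FiniteDimensional ℝ E] {v : E → E} (hv : ContDiff ℝ 1 v)
    (hinner : ∀ y, ⟪y, v y⟫_ℝ = 0) (x : E) :
    ∃ Y : ℝ → E, Y 0 = x ∧ ∀ t, HasDerivAt Y (v (Y t)) t := by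
  let χ : ContDiffBump (0 : E) := ⟨‖x‖ + 1, ‖x‖ + 2, by positivity, by linarith⟩
  have hw : ContDiff ℝ 1 fun y => χ y • v y := χ.contDiff.smul hv
  have hsupp : HasCompactSupport fun y => χ y • v y := χ.hasCompactSupport.smul_right
  obtain ⟨K, hK⟩ := hw.lipschitzWith_of_hasCompactSupport hsupp one_ne_zero
  obtain ⟨C, hC⟩ := hsupp.exists_bound_of_continuous hw.continuous
  obtain ⟨Y, hY0, hY⟩ := exists_forall_hasDerivAt_of_lipschitzWith hK (C := C.toNNReal)
    (fun y => (hC y).trans (Real.le_coe_toNNReal C)) x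
  have hnorm : ∀ t, ‖Y t‖ = ‖x‖ := by
    intro t
    have hderiv : ∀ s, HasDerivAt (fun s => ‖Y s‖ ^ 2) 0 s := fun s => by
      simpa [inner_smul_right, hinner] using (hY s).norm_sq
    have := is_const_of_deriv_eq_zero (fun s => (hderiv s).differentiableAt)
      (fun s => (hderiv s).deriv) t 0
    simpa [hY0] using this
  refine ⟨Y, hY0, fun t => ?_⟩
  have hχ : χ (Y t) = 1 := χ.one_of_mem_closedBall (by simp [hnorm, χ])
  simpa [hχ] using hY t

theorem gronwallBound_zero_eq_mul (K ε x : ℝ) :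
    gronwallBound 0 K ε x = ε * gronwallBound 0 K 1 x := by
  by_cases hK : K = 0
  · simp [gronwallBound, hK]
  · simp only [gronwallBound, hK]
    simp
    ring

/-- A curve whose velocity is `c ‖D‖`-close to `J D` stays close to the flow of `J`. -/
theorem norm_sub_exp_smul_le {E : Type*} [NormedAddCommGroup E] [NormedSpace ℝ E]
    [CompleteSpace E] {J : E →L[ℝ] E} {c : ℝ} (hc₀ : 0 ≤ c) (hc₁ : c ≤ 1) {D D' : ℝ → E}
    {a h : ℝ} (hh : 0 ≤ h)
    (hD : ∀ t, HasDerivAt D (D' t) t)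
    (hbound : ∀ t ∈ Set.Ico a (a + h), ‖D' t - J (D t)‖ ≤ c * ‖D t‖) :
    ‖D (a + h) - NormedSpace.exp (h • J) (D a)‖ ≤
      c * (Real.exp ((‖J‖ + 1) * h) * gronwallBound 0 ‖J‖ 1 h) * ‖D a‖ := by
  have hcont : Continuous D := continuous_iff_continuousAt.2 fun t => (hD t).continuousAt
  have hmem : a + h ∈ Set.Icc a (a + h) := ⟨by linarith, le_rfl⟩
  have hgrow : ∀ t ∈ Set.Icc a (a + h), ‖D t‖ ≤ ‖D a‖ * Real.exp ((‖J‖ + 1) * h) := by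
    intro t ht
    have hle := norm_le_gronwallBound_of_norm_deriv_right_le (K := ‖J‖ + 1) (ε := 0)
      hcont.continuousOn (fun t _ => (hD t).hasDerivWithinAt) le_rfl (fun s hs => ?_) t ht
    · rw [gronwallBound_ε0] at hle
      refine hle.trans ?_
      gcongr
      linarith [ht.2]
    · have h₁ : ‖D' s‖ ≤ ‖D' s - J (D s)‖ + ‖J (D s)‖ := by
        simpa using norm_add_le (D' s - J (D s)) (J (D s))
      nlinarith [hbound s hs, J.le_opNorm (D s), norm_nonneg (D s)]
  let G : ℝ → E := fun t => NormedSpace.exp ((t - a) • J) (D a)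
  have hG : ∀ t, HasDerivAt G (J (G t)) t := fun t => by
    have hexp := (hasDerivAt_exp_smul_const' (𝕂 := ℝ) J (t - a)).comp_sub_const t a
    exact hexp.clm_apply (hasDerivAt_const t (D a)) |>.congr_deriv (by simp [G])
  have hGcont : Continuous G := continuous_iff_continuousAt.2 fun t => (hG t).continuousAt
  have key := dist_le_of_approx_trajectories_ODE (v := fun _ => J) (K := ‖J‖₊) (δ := 0)
    (εf := c * (‖D a‖ * Real.exp ((‖J‖ + 1) * h))) (εg := 0) (fun _ => J.lipschitz)
    hcont.continuousOn (fun t _ => (hD t).hasDerivWithinAt)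
    (fun t ht => by
      rw [dist_eq_norm]
      exact (hbound t ht).trans
        (mul_le_mul_of_nonneg_left (hgrow t (Set.Ico_subset_Icc_self ht)) hc₀))
    hGcont.continuousOn (fun t _ => (hG t).hasDerivWithinAt) (by simp) (by simp [G]) (a + h) hmem
  rw [gronwallBound_zero_eq_mul, dist_eq_norm] at key
  simp only [G, add_sub_cancel_left, add_zero, coe_nnnorm] at key
  linarith

/-- If the linearisation at `X` of a complete vector field has positive trace, then `X` is not
Lyapunov stable: otherwise a time-`h` map of the flow would expand the volume of sets which remain
in a fixed ball by a factor larger than one. -/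
theorem exists_unstable_of_trace_pos {E : Type*} [NormedAddCommGroup E] [NormedSpace ℝ E]
    [FiniteDimensional ℝ E] {v : E → E} {X : E} {J : E →L[ℝ] E} (hv : HasStrictFDerivAt v J X)
    (hJ : 0 < LinearMap.trace ℝ E J)
    (hglobal : ∀ x, ∃ Y : ℝ → E, Y 0 = x ∧ ∀ t, HasDerivAt Y (v (Y t)) t) :
    ∃ ε > 0, ∀ δ > 0, ∃ Y : ℝ → E, (∀ t, HasDerivAt Y (v (Y t)) t) ∧ ‖Y 0 - X‖ < δ ∧
      ∃ t ≥ 0, ε ≤ ‖Y t - X‖ := by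
  let _ : MeasurableSpace E := borel E
  have : BorelSpace E := ⟨rfl⟩
  let μ : MeasureTheory.Measure E := MeasureTheory.Measure.addHaar
  obtain ⟨h, hh, hdet⟩ := ContinuousLinearMap.exists_one_lt_det_exp_smul hJ
  obtain ⟨m, hm1, hm⟩ : ∃ m : NNReal, 1 < m ∧
      (m : ENNReal) < ENNReal.ofReal |(NormedSpace.exp (h • J)).det| := by
    have : (1 : ENNReal) < ENNReal.ofReal |(NormedSpace.exp (h • J)).det| := by
      rw [ENNReal.one_lt_ofReal]
      exact hdet.trans_le (le_abs_self _)
    obtain ⟨m, hm1, hm⟩ := ENNReal.lt_iff_exists_nnreal_btwn.1 this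
    exact ⟨m, by exact_mod_cast hm1, hm⟩
  obtain ⟨κ, hκ, hκpos⟩ :=
    ((MeasureTheory.mul_le_addHaar_image_of_lt_det μ _ hm).and self_mem_nhdsWithin).exists
  replace hκpos : 0 < κ := hκpos
  set C : ℝ := Real.exp ((‖J‖ + 1) * h) * gronwallBound 0 ‖J‖ 1 h
  obtain ⟨c, hc₀, hc₁, hcκ⟩ : ∃ c : NNReal, 0 < c ∧ c ≤ 1 ∧ c * C ≤ κ := by
    have hlim : Filter.Tendsto (fun c : NNReal => (c : ℝ) * C) (nhds 0) (nhds 0) :=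
      (by fun_prop : Continuous fun c : NNReal => (c : ℝ) * C).tendsto' _ _ (by simp)
    obtain ⟨c, ⟨hcκ, hc₁⟩, hc₀⟩ := ((((hlim.eventually (ge_mem_nhds (by exact_mod_cast hκpos))).and
      (ge_mem_nhds zero_lt_one)).filter_mono nhdsWithin_le_nhds).and
        (self_mem_nhdsWithin (s := Set.Ioi (0 : NNReal)))).exists
    exact ⟨c, hc₀, hc₁, hcκ⟩
  obtain ⟨s, hs, happrox⟩ := hv.approximates_deriv_on_nhds (c := c) (Or.inr hc₀)
  obtain ⟨ε, hε, hεs⟩ := Metric.mem_nhds_iff.1 hs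
  refine ⟨ε, hε, fun δ hδ => ?_⟩
  by_contra! hstable
  let T : ℕ → Set E := fun n => {y | ∃ Y : ℝ → E, (∀ t, HasDerivAt Y (v (Y t)) t) ∧
    ‖Y 0 - X‖ < δ ∧ Y (n * h) = y}
  have hgrow : ∀ n, (m : ENNReal) * μ (T n) ≤ μ (T (n + 1)) := by
    intro n
    have hT : ∀ y ∈ T n, ∃ Y : ℝ → E, (∀ t, HasDerivAt Y (v (Y t)) t) ∧
      ‖Y 0 - X‖ < δ ∧ Y (n * h) = y := fun y hy => hy
    choose! Y hYsol hY0 hYn using hT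
    refine (hκ (T n) (fun y => Y y (n * h + h)) fun y hy z hz => ?_).trans
      (MeasureTheory.measure_mono ?_)
    · have hle := norm_sub_exp_smul_le (J := J) c.coe_nonneg hc₁ hh.le (a := n * h)
        (fun t => (hYsol y hy t).sub (hYsol z hz t)) fun t ht => ?_
      · simp only [Pi.sub_apply, hYn y hy, hYn z hz] at hle
        exact hle.trans (mul_le_mul_of_nonneg_right hcκ (norm_nonneg _))
      · have ht0 : 0 ≤ t := le_trans (by positivity) ht.1
        have hball : ∀ w ∈ T n, Y w t ∈ s := fun w hw => hεs <| by
          rw [Metric.mem_ball, dist_eq_norm]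
          exact hstable (Y w) (hYsol w hw) (hY0 w hw) t ht0
        exact happrox _ (hball y hy) _ (hball z hz)
    · rintro _ ⟨y, hy, rfl⟩
      refine ⟨Y y, hYsol y hy, hY0 y hy, ?_⟩
      push_cast
      ring_nf
  have hpow : ∀ n, (m : ENNReal) ^ n * μ (T 0) ≤ μ (T n) := by
    intro n
    induction n with
    | zero => simp
    | succ n ih =>
      calc _ = (m : ENNReal) * ((m : ENNReal) ^ n * μ (T 0)) := by ring
        _ ≤ m * μ (T n) := by gcongr
        _ ≤ _ := hgrow n
  have hbdd : ∀ n, μ (T n) ≤ μ (Metric.ball X ε) := fun n => by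
    refine MeasureTheory.measure_mono ?_
    rintro _ ⟨Y, hY, hY0, rfl⟩
    rw [Metric.mem_ball, dist_eq_norm]
    exact hstable Y hY hY0 _ (by positivity)
  have hT0 : 0 < μ (T 0) := by
    refine (Metric.measure_ball_pos μ X hδ).trans_le (MeasureTheory.measure_mono fun y hy => ?_)
    obtain ⟨Y, hY0, hY⟩ := hglobal y
    rw [Metric.mem_ball, dist_eq_norm] at hy
    exact ⟨Y, hY, by rwa [hY0], by simpa using hY0⟩
  have hlim : Filter.Tendsto (fun n : ℕ => (m : ENNReal) ^ n * μ (T 0)) Filter.atTop (nhds ⊤) := by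
    have := ENNReal.Tendsto.mul_const (b := μ (T 0))
      (ENNReal.tendsto_pow_atTop_nhds_top_iff.2 (ENNReal.one_lt_coe_iff.2 hm1)) (Or.inl ENNReal.top_ne_zero)
    rwa [ENNReal.top_mul hT0.ne'] at this
  have htop := top_le_iff.1 (le_of_tendsto' hlim fun n => (hpow n).trans (hbdd n))
  exact MeasureTheory.measure_ball_lt_top.ne htop

theorem LieStructure.bracket_skew {g : Type*} [NormedAddCommGroup g] [InnerProductSpace ℝ g]
    (L : LieStructure g) (X Y : g) : L.bracket X Y = -L.bracket Y X := by
  have h := L.bracket_self (X + Y)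
  simp only [map_add, LinearMap.add_apply, L.bracket_self, zero_add, add_zero] at h
  exact eq_neg_of_add_eq_zero_right h

theorem LieStructure.trace_ad_bracket {g : Type*} [NormedAddCommGroup g] [InnerProductSpace ℝ g]
    (L : LieStructure g) (X Y : g) : LinearMap.trace ℝ g (L.ad (L.bracket X Y)) = 0 := by
  have h : L.ad (L.bracket X Y) = L.ad X * L.ad Y - L.ad Y * L.ad X := by
    ext Z
    have hj := L.jacobi X Y Z
    rw [L.bracket_skew Z (L.bracket X Y), L.bracket_skew Z X, map_neg] at hj
    simp only [LieStructure.ad, LinearMap.sub_apply, Module.End.mul_apply]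
    rw [← sub_eq_zero, ← neg_eq_zero, ← hj]
    abel
  rw [h, map_sub, LinearMap.trace_mul_comm, sub_self]

namespace LieStructure

variable {g : Type*} [NormedAddCommGroup g] [InnerProductSpace ℝ g] [FiniteDimensional ℝ g]
variable (L : LieStructure g)

theorem inner_adT (X Y Z : g) : ⟪L.adT X Y, Z⟫_ℝ = ⟪Y, L.bracket X Z⟫_ℝ :=
  LinearMap.adjoint_inner_left _ _ _

theorem trace_J (X : g) : LinearMap.trace ℝ g (L.J X) = LinearMap.trace ℝ g (L.ad X) := by
  let b := stdOrthonormalBasis ℝ g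
  rw [LinearMap.trace_eq_sum_inner _ b, LinearMap.trace_eq_sum_inner _ b]
  refine Finset.sum_congr rfl fun i _ => ?_
  change ⟪b i, L.adT X (b i) + L.adT (b i) X⟫_ℝ = ⟪b i, L.bracket X (b i)⟫_ℝ
  rw [inner_add_right, real_inner_comm, L.inner_adT, real_inner_comm (L.adT (b i) X), L.inner_adT,
    L.bracket_self, inner_zero_right, add_zero, real_inner_comm]

/-- The map `Y ↦ ad_Yᵗ` as a continuous linear map into the continuous endomorphisms. -/
noncomputable def adTCLM : g →L[ℝ] g →L[ℝ] g :=
  LinearMap.toContinuousLinearMap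
    { toFun := fun Y => LinearMap.toContinuousLinearMap (L.adT Y)
      map_add' := fun Y Z => by simp [adT, ad]
      map_smul' := fun c Y => by simp [adT, ad] }

theorem hasStrictFDerivAt_adT (X : g) :
    HasStrictFDerivAt (fun Y => L.adT Y Y) (LinearMap.toContinuousLinearMap (L.J X)) X := by
  have h := (L.adTCLM.hasStrictFDerivAt (x := X)).clm_apply (hasStrictFDerivAt_id X)
  exact h.congr_fderiv (by ext Y; rfl)

theorem exists_isSolution (x : g) : ∃ Y : ℝ → g, Y 0 = x ∧ L.IsSolution Y := by
  refine exists_forall_hasDerivAt_of_inner_eq_zero (v := fun Y => L.adT Y Y) ?_ (fun y => ?_) x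
  · exact L.adTCLM.contDiff.clm_apply contDiff_id
  · rw [real_inner_comm, L.inner_adT, L.bracket_self, inner_zero_right]

theorem not_isStable_of_trace_ad_pos {X : g} (hX : 0 < LinearMap.trace ℝ g (L.ad X)) :
    ¬ L.IsStable X := by
  intro hst
  obtain ⟨ε, hε, hunst⟩ := exists_unstable_of_trace_pos (L.hasStrictFDerivAt_adT X)
    (by simpa [L.trace_J] using hX) L.exists_isSolution
  obtain ⟨δ, hδ, hst⟩ := hst ε hε
  obtain ⟨Y, hY, hY0, t, ht, hle⟩ := hunst δ hδ
  exact (hst Y hY hY0 t ht).not_ge hle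

theorem isStationary_of_orthogonal {X : g}
    (hX : ∀ Y : g, LinearMap.trace ℝ g (L.ad Y) = 0 → ⟪X, Y⟫_ℝ = 0) : L.IsStationary X := by
  refine ext_inner_right ℝ fun Y => ?_
  rw [L.inner_adT, inner_zero_left]
  exact hX _ (L.trace_ad_bracket X Y)

theorem IsStationary.neg {X : g} (hX : L.IsStationary X) : L.IsStationary (-X) := by
  simpa [IsStationary, adT, ad] using hX

end LieStructure

/-- In a non-unimodular metric Lie algebra, every nonzero `X` orthogonal to the unimodular
ideal `u = {Y : Tr ad_Y = 0}` is stationary and one of `X`, `-X` is unstable; in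
particular there is an unstable stationary point. -/
theorem exists_unstable_of_nonunimodular    {g : Type*} [NormedAddCommGroup g] [InnerProductSpace ℝ g] [FiniteDimensional ℝ g]
    (L : LieStructure g)
    (hnonuni : ∃ X₀ : g, LinearMap.trace ℝ g (L.ad X₀) ≠ 0) :
    (∀ X : g, X ≠ 0 → (∀ Y : g, LinearMap.trace ℝ g (L.ad Y) = 0 → ⟪X, Y⟫_ℝ = 0) →
      L.IsStationary X ∧ (¬ L.IsStable X ∨ ¬ L.IsStable (-X))) ∧
    ∃ X : g, L.IsStationary X ∧ ¬ L.IsStable X := by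
  have key : ∀ X : g, X ≠ 0 → (∀ Y : g, LinearMap.trace ℝ g (L.ad Y) = 0 → ⟪X, Y⟫_ℝ = 0) →
      L.IsStationary X ∧ (¬ L.IsStable X ∨ ¬ L.IsStable (-X)) := by
    intro X hX hort
    refine ⟨L.isStationary_of_orthogonal hort, ?_⟩
    have htr : LinearMap.trace ℝ g (L.ad X) ≠ 0 := fun h => hX (inner_self_eq_zero.1 (hort X h))
    rcases htr.lt_or_gt with hneg | hpos
    · exact Or.inr (L.not_isStable_of_trace_ad_pos (by simpa [LieStructure.ad] using hneg))
    · exact Or.inl (L.not_isStable_of_trace_ad_pos hpos)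
  refine ⟨key, ?_⟩
  let τ : g →L[ℝ] ℝ := LinearMap.toContinuousLinearMap (LinearMap.trace ℝ g ∘ₗ L.bracket)
  let X : g := (InnerProductSpace.toDual ℝ g).symm τ
  have hX : ∀ Y, ⟪X, Y⟫_ℝ = LinearMap.trace ℝ g (L.ad Y) := fun Y =>
    InnerProductSpace.toDual_symm_apply
  have hX0 : X ≠ 0 := by
    rintro h
    obtain ⟨X₀, hX₀⟩ := hnonuni
    exact hX₀ (by rw [← hX, h, inner_zero_left])
  obtain ⟨hstat, h | h⟩ := key X hX0 fun Y hY => (hX Y).trans hY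
  · exact ⟨X, hstat, h⟩
  · exact ⟨-X, hstat.neg, h⟩
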